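/- Let m be an even positive integer, n a positive integer, and s an integer with s² ≡ 1 (mod n), and let G_{m,n,s} = ⟨x, y | x^m = y^n = 1, yx = xy^s⟩. Then x² commutes with y in G_{m,n,s}, and the element x²y has order lcm(m/2, n). -/

import Mathlib

/-- A sequence (multiset) over a group is *product-one* if its terms can be
ordered so that their product is `1`. -/
def IsProductOne {G : Type*} [Group G] (S : Multiset G) : Prop :=
  ∃ l : List G, (l : Multiset G) = S ∧ l.prod = 1

/-- A sequence is *product-one free* if no nonempty subsequence is product-one. -/
def ProductOneFree {G : Type*} [Group G] (S : Multiset G) : Prop :=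
  ∀ T : Multiset G, T ≤ S → T ≠ 0 → ¬ IsProductOne T

/-- The small Davenport constant: maximal length of a product-one free sequence. -/
noncomputable def smallDavenport (G : Type*) [Group G] : ℕ :=
  sSup {k : ℕ | ∃ S : Multiset G, Multiset.card S = k ∧ ProductOneFree S}

/-- The Gao constant: the least `ℓ > 0` such that every sequence of length at least `ℓ`
contains a product-one subsequence of length `|G|`. -/
noncomputable def gaoConstant (G : Type*) [Group G] : ℕ :=
  sInf {ℓ : ℕ | 0 < ℓ ∧ ∀ S : Multiset G, ℓ ≤ Multiset.card S →
    ∃ T : Multiset G, T ≤ S ∧ Multiset.card T = Nat.card G ∧ IsProductOne T}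

/-- Relations of the metacyclic group `⟨x, y ∣ x^m = y^n = 1, y*x = x*y^s⟩`. -/
def metacyclicRels (m n : ℕ) (s : ℤ) : Set (FreeGroup (Fin 2)) :=
  {FreeGroup.of 0 ^ m, FreeGroup.of 1 ^ n,
    FreeGroup.of 1 * FreeGroup.of 0 * (FreeGroup.of 0 * FreeGroup.of 1 ^ s)⁻¹}

/-- The metacyclic group `G_{m,n,s} = Cₙ ⋊ₛ Cₘ = ⟨x, y ∣ x^m = y^n = 1, y*x = x*y^s⟩`. -/
abbrev Metacyclic (m n : ℕ) (s : ℤ) : Type := PresentedGroup (metacyclicRels m n s)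

/-- The generator `x` of `G_{m,n,s}`. -/
def mcX (m n : ℕ) (s : ℤ) : Metacyclic m n s := PresentedGroup.of 0

/-- The generator `y` of `G_{m,n,s}`. -/
def mcY (m n : ℕ) (s : ℤ) : Metacyclic m n s := PresentedGroup.of 1

theorem mc_rel (m n : ℕ) (s : ℤ) :
    mcX m n s ^ m = 1 ∧ mcY m n s ^ n = 1 ∧
      mcY m n s * mcX m n s = mcX m n s * mcY m n s ^ s := by
  have h : ∀ r ∈ metacyclicRels m n s, PresentedGroup.mk (metacyclicRels m n s) r = 1 :=
    fun r hr => PresentedGroup.one_of_mem hr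
  refine ⟨?_, ?_, ?_⟩
  · have := h (FreeGroup.of 0 ^ m) (by simp [metacyclicRels])
    rw [map_pow] at this
    exact this
  · have := h (FreeGroup.of 1 ^ n) (by simp [metacyclicRels])
    rw [map_pow] at this
    exact this
  · have := h (FreeGroup.of 1 * FreeGroup.of 0 * (FreeGroup.of 0 * FreeGroup.of 1 ^ s)⁻¹)
      (by simp [metacyclicRels])
    rw [map_mul, map_inv, mul_inv_eq_one, map_mul, map_mul, map_zpow] at this
    exact this

theorem mc_lift (m n : ℕ) (s : ℤ) {H : Type*} [Group H] (a b : H) (ha : a ^ m = 1)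
    (hb : b ^ n = 1) (hab : b * a = a * b ^ s) :
    ∃ f : Metacyclic m n s →* H, f (mcX m n s) = a ∧ f (mcY m n s) = b := by
  have h : ∀ r ∈ metacyclicRels m n s, FreeGroup.lift ![a, b] r = 1 := by
    intro r hr
    rcases hr with rfl | rfl | rfl
    · simpa using ha
    · simpa using hb
    · rw [map_mul, map_inv, mul_inv_eq_one]
      simpa using hab
  refine ⟨PresentedGroup.toGroup h, ?_, ?_⟩
  · exact (PresentedGroup.toGroup.of h).trans (by simp)
  · exact (PresentedGroup.toGroup.of h).trans (by simp)

/-- For `m` even and `s² ≡ 1 (mod n)`, in `G_{m,n,s}` the element `x²` commutes with `y`,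
and `x²y` has order `lcm(m/2, n)`. -/
theorem x_sq_y_order (m n : ℕ) (hm : 0 < m) (hme : Even m) (hn : 0 < n) (s : ℤ)
    (hs : (s : ZMod n) ^ 2 = 1) :
    mcX m n s ^ 2 * mcY m n s = mcY m n s * mcX m n s ^ 2 ∧
    orderOf (mcX m n s ^ 2 * mcY m n s) = Nat.lcm (m / 2) n := by
  obtain ⟨hx, hy, hxy⟩ := mc_rel m n s
  have hcomm : mcX m n s ^ 2 * mcY m n s = mcY m n s * mcX m n s ^ 2 := by
    have h1 : SemiconjBy (mcX m n s) (mcY m n s ^ s) (mcY m n s) := hxy.symm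
    have h2 := h1.mul_left (h1.zpow_right s)
    have h3 : (mcY m n s ^ s) ^ s = mcY m n s := by
      have hd : (n : ℤ) ∣ s * s - 1 := by
        rw [← ZMod.intCast_zmod_eq_zero_iff_dvd]
        push_cast
        rw [← pow_two, hs, sub_self]
      obtain ⟨c, hc⟩ := hd
      have : s * s = n * c + 1 := by linarith
      rw [← zpow_mul, this, zpow_add, zpow_mul, zpow_natCast, hy]
      simp
    rw [h3, ← pow_two] at h2
    exact h2
  refine ⟨hcomm, Nat.dvd_antisymm ?_ (Nat.lcm_dvd ?_ ?_)⟩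
  · apply orderOf_dvd_of_pow_eq_one
    rw [Commute.mul_pow hcomm]
    obtain ⟨c, hc⟩ := Nat.dvd_lcm_left (m / 2) n
    obtain ⟨d, hd⟩ := Nat.dvd_lcm_right (m / 2) n
    have h2 : 2 * (m / 2) = m := Nat.two_mul_div_two_of_even hme
    have e1 : (mcX m n s ^ 2) ^ (Nat.lcm (m / 2) n) = 1 := by
      rw [hc, ← pow_mul, ← mul_assoc, h2, pow_mul, hx, one_pow]
    have e2 : mcY m n s ^ (Nat.lcm (m / 2) n) = 1 := by
      rw [hd, pow_mul, hy, one_pow]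
    rw [e1, e2, one_mul]
  · obtain ⟨f, fx, fy⟩ := mc_lift m n s (H := Multiplicative (ZMod m))
      (Multiplicative.ofAdd 1) 1 (by rw [← ofAdd_nsmul]; simp) (by simp) (by simp)
    have h := congrArg f (pow_orderOf_eq_one (mcX m n s ^ 2 * mcY m n s))
    generalize orderOf (mcX m n s ^ 2 * mcY m n s) = k at h ⊢
    rw [map_pow, map_mul, map_pow, fx, fy, mul_one, ← pow_mul, ← ofAdd_nsmul, map_one,
      ofAdd_eq_one, nsmul_one, ZMod.natCast_eq_zero_iff] at h
    obtain ⟨c, hc⟩ := h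
    refine ⟨c, ?_⟩
    have h2 : 2 * (m / 2) = m := Nat.two_mul_div_two_of_even hme
    rw [← h2, mul_assoc] at hc
    exact Nat.eq_of_mul_eq_mul_left two_pos hc
  · have hss : (s : ZMod n) * s = 1 := by rw [← pow_two, hs]
    let a : Equiv.Perm (ZMod n) :=
      ⟨fun t => s * t, fun t => s * t, fun t => by simp [← mul_assoc, hss],
        fun t => by simp [← mul_assoc, hss]⟩
    have ha2 : a ^ 2 = 1 := by
      ext1 t
      simp [a, pow_two, ← mul_assoc, hss]
    obtain ⟨f, fx, fy⟩ := mc_lift m n s a (Equiv.addRight (1 : ZMod n))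
      (by obtain ⟨c, rfl⟩ := hme; rw [← two_mul, pow_mul, ha2, one_pow])
      (by ext1 t; simp)
      (by ext1 t; simp [a, mul_add, hss])
    have h := congrArg f (pow_orderOf_eq_one (mcX m n s ^ 2 * mcY m n s))
    generalize orderOf (mcX m n s ^ 2 * mcY m n s) = k at h ⊢
    rw [map_pow, map_mul, map_pow, fx, fy, ha2, one_mul, map_one] at h
    have h0 := congrArg (fun e : Equiv.Perm (ZMod n) => e 0) h
    simp at h0
    exact (ZMod.natCast_eq_zero_iff _ _).1 h0
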